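/- Let B be a Boolean contact algebra satisfying (DV7). Then for every x ≠ 0 there exists a round filter F of B with x ∈ F. -/

import Mathlib

variable {B : Type*} [BooleanAlgebra B]

/-- A Boolean contact algebra structure on a Boolean algebra `B`. -/
structure BCA (B : Type*) [BooleanAlgebra B] where
  C : B → B → Prop
  c0 : ∀ x : B, ¬ C ⊥ x
  c1 : ∀ x y : B, x ≠ ⊥ → x ≤ y → C x y
  c2 : ∀ x y : B, C x y → C y x
  c3 : ∀ x y z : B, x ≤ y → C z x → C z y
  c4 : ∀ x y z : B, C x (y ⊔ z) → C x y ∨ C x z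

namespace BCA

/-- The well-inside relation: `x ≪ y` iff `¬ (x C yᶜ)`. -/
def wi (A : BCA B) (x y : B) : Prop := ¬ A.C x yᶜ

/-- `Q₁` covers `Q₂` iff every element of `Q₁` contains some element of `Q₂`. -/
def Covers (Q₁ Q₂ : Set B) : Prop := ∀ x ∈ Q₁, ∃ y ∈ Q₂, y ≤ x

/-- A Grzegorczyk representative of a point. -/
def IsGRep (A : BCA B) (Q : Set B) : Prop :=
  Q.Nonempty ∧ (⊥ : B) ∉ Q ∧
    (∀ u ∈ Q, ∀ v ∈ Q, u = v ∨ A.wi u v ∨ A.wi v u) ∧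
    (∀ u ∈ Q, ∃ v ∈ Q, A.wi v u) ∧
    (∀ x y : B, (∀ u ∈ Q, u ⊓ x ≠ ⊥ ∧ u ⊓ y ≠ ⊥) → A.C x y)

/-- An abstractive set. -/
def IsAbstractive (A : BCA B) (S : Set B) : Prop :=
  S.Nonempty ∧ (⊥ : B) ∉ S ∧
    (∀ u ∈ S, ∀ v ∈ S, u = v ∨ A.wi u v ∨ A.wi v u) ∧
    ¬ ∃ x ∈ S, ∀ y ∈ S, x ≤ y

/-- A Whitehead representative of a point. -/
def IsWRep (A : BCA B) (S : Set B) : Prop :=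
  A.IsAbstractive S ∧ ∀ T : Set B, A.IsAbstractive T → Covers S T → Covers T S

/-- An ω-abstractive set: an abstractive set mutually covering with a countable abstractive set. -/
def IsOmegaAbstractive (A : BCA B) (S : Set B) : Prop :=
  A.IsAbstractive S ∧
    ∃ T : Set B, T.Countable ∧ A.IsAbstractive T ∧ Covers S T ∧ Covers T S

/-- A filter of the Boolean algebra `B`. -/
def IsFilter (F : Set B) : Prop :=
  F.Nonempty ∧ (⊥ : B) ∉ F ∧
    (∀ x ∈ F, ∀ y : B, x ≤ y → y ∈ F) ∧
    (∀ x ∈ F, ∀ y ∈ F, x ⊓ y ∈ F)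

/-- A round filter. -/
def IsRoundFilter (A : BCA B) (F : Set B) : Prop :=
  IsFilter F ∧ ∀ x ∈ F, ∃ y ∈ F, A.wi y x

/-- A Grzegorczyk point: the filter generated by a G-representative. -/
def IsGPoint (A : BCA B) (G : Set B) : Prop :=
  ∃ Q : Set B, A.IsGRep Q ∧ G = {y : B | ∃ x ∈ Q, x ≤ y}

/-- Atomlessness of the Boolean algebra. -/
def Atomless (B : Type*) [BooleanAlgebra B] : Prop :=
  ∀ x : B, x ≠ ⊥ → ∃ y : B, y ≠ ⊥ ∧ y < x

/-- The interpolation axiom (DV6). -/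
def DV6 (A : BCA B) : Prop := ∀ x y : B, A.wi x y → ∃ z : B, A.wi x z ∧ A.wi z y

/-- The non-tangential part axiom (DV7). -/
def DV7 (A : BCA B) : Prop := ∀ x : B, x ≠ ⊥ → ∃ y : B, y ≠ ⊥ ∧ A.wi y x

/-- The connectedness axiom (C5). -/
def C5 (A : BCA B) : Prop := ∀ x : B, x ≠ ⊥ → x ≠ ⊤ → A.C x xᶜ

/-- The countable chain condition for a Boolean algebra. -/
def CCC (B : Type*) [BooleanAlgebra B] : Prop :=
  ∀ S : Set B, (∀ x ∈ S, x ≠ ⊥) → (S.Pairwise fun x y => x ⊓ y = ⊥) → S.Countable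

end BCA

namespace BCA

variable {A : BCA B}

theorem wi.le {x y : B} (h : A.wi x y) : x ≤ y := by
  by_contra hxy
  have hne : x ⊓ yᶜ ≠ ⊥ := fun h0 => hxy (by simpa [← sdiff_eq] using h0)
  exact h (A.c2 _ _ (A.c3 _ _ _ inf_le_left (A.c2 _ _ (A.c1 _ _ hne inf_le_right))))

theorem wi.trans_le {x y z : B} (h : A.wi x y) (hyz : y ≤ z) : A.wi x z :=
  fun hc => h (A.c3 _ _ _ (compl_le_compl hyz) hc)

/-- The upward closure of a sequence of nonzero elements, each well inside its predecessor,
is a round filter. -/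
theorem isRoundFilter_of_seq {u : ℕ → B} (hne : ∀ n, u n ≠ ⊥)
    (hwi : ∀ n, A.wi (u (n + 1)) (u n)) : A.IsRoundFilter {y | ∃ n, u n ≤ y} := by
  have hanti : Antitone u := antitone_nat_of_succ_le fun n => (hwi n).le
  refine ⟨⟨⟨u 0, 0, le_rfl⟩, ?_, ?_, ?_⟩, ?_⟩
  · rintro ⟨n, hn⟩
    exact hne n (le_bot_iff.mp hn)
  · rintro a ⟨n, hn⟩ b hab
    exact ⟨n, hn.trans hab⟩
  · rintro a ⟨n, hn⟩ b ⟨m, hm⟩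
    exact ⟨max n m, le_inf ((hanti (le_max_left n m)).trans hn)
      ((hanti (le_max_right n m)).trans hm)⟩
  · rintro a ⟨n, hn⟩
    exact ⟨u (n + 1), ⟨n + 1, le_rfl⟩, (hwi n).trans_le hn⟩

end BCA

theorem stmt_13 {B : Type*} [BooleanAlgebra B] (A : BCA B) (hdv7 : A.DV7)
    (x : B) (hx : x ≠ ⊥) : ∃ F : Set B, A.IsRoundFilter F ∧ x ∈ F := by
  choose f hf hfwi using hdv7
  let u : ℕ → {y : B // y ≠ ⊥} :=
    fun n => Nat.rec ⟨x, hx⟩ (fun _ y => ⟨f y.1 y.2, hf y.1 y.2⟩) n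
  exact ⟨{y | ∃ n, (u n).1 ≤ y},
    BCA.isRoundFilter_of_seq (fun n => (u n).2) fun n => hfwi (u n).1 (u n).2, 0, le_rfl⟩
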